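/- Let n ≥ 2 be an integer, let s ∈ (0, π), and let F and its Taylor coefficients (a_m) be as in the context. Then there exists a constant C (depending on n and s) such that for every integer m ≥ 1, | a_m − ( 2 cos(s/2) / (2π sin s)^{(n+1)/2} ) · m^{(n−1)/2} · cos( (n/2 + m) s − (n+1)π/4 ) | ≤ C m^{(n−3)/2}. -/

import Mathlib

open MeasureTheory Real Filter

open Asymptotics

theorem succ_mul_multichoose_succ (β : ℝ) (k : ℕ) :
    ((k : ℝ) + 1) * Ring.multichoose β (k + 1) = (β + k) * Ring.multichoose β k := by
  have h1 := Ring.factorial_nsmul_multichoose_eq_ascPochhammer β (k + 1)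
  have h2 := Ring.factorial_nsmul_multichoose_eq_ascPochhammer β k
  rw [Polynomial.ascPochhammer_smeval_eq_eval] at h1 h2
  rw [ascPochhammer_succ_eval, ← h2, Nat.factorial_succ] at h1
  simp only [nsmul_eq_mul, Nat.cast_mul, Nat.cast_add, Nat.cast_one] at h1
  have hk : (k.factorial : ℝ) ≠ 0 := by positivity
  apply mul_left_cancel₀ hk
  linear_combination h1

theorem mul_multichoose_add_one (β : ℝ) (k : ℕ) :
    β * Ring.multichoose (β + 1) k = (β + k) * Ring.multichoose β k := by
  induction k with
  | zero => simp
  | succ k ih =>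
    have h1 := succ_mul_multichoose_succ β k
    have h2 := succ_mul_multichoose_succ (β + 1) k
    have hk : (k : ℝ) + 1 ≠ 0 := by positivity
    apply mul_left_cancel₀ hk
    push_cast
    linear_combination β * h2 + (β + 1 + k) * ih - (β + 1 + k) * h1

theorem multichoose_eq_Gamma_div {β : ℝ} (hβ : 0 < β) (k : ℕ) :
    Ring.multichoose β k = Gamma (k + β) / (Gamma (k + 1) * Gamma β) := by
  induction k with
  | zero => simp [(Gamma_pos_of_pos hβ).ne']
  | succ k ih =>
    have h1 := succ_mul_multichoose_succ β k
    have hk : (k : ℝ) + 1 ≠ 0 := by positivity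
    have e1 : Gamma (((k + 1 : ℕ) : ℝ) + β) = (k + β) * Gamma (k + β) := by
      rw [← Gamma_add_one (by positivity)]; push_cast; ring_nf
    have e2 : Gamma (((k + 1 : ℕ) : ℝ) + 1) = (k + 1) * Gamma (k + 1) := by
      rw [← Gamma_add_one (by positivity)]; push_cast; ring_nf
    rw [e1, e2]
    apply mul_left_cancel₀ hk
    rw [h1, ih]
    have := (Gamma_pos_of_pos hβ).ne'
    have := (Gamma_pos_of_pos (show (0 : ℝ) < k + 1 by positivity)).ne'
    field_simp
    ring

theorem isBigO_natCast_rpow_of_le {r r' : ℝ} (h : r ≤ r') :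
    (fun k : ℕ => (k : ℝ) ^ r) =O[atTop] (fun k : ℕ => (k : ℝ) ^ r') := by
  apply IsBigO.of_bound 1
  filter_upwards [eventually_ge_atTop 1] with k hk
  have hk0 : (1 : ℝ) ≤ k := by exact_mod_cast hk
  rw [one_mul, Real.norm_of_nonneg (by positivity), Real.norm_of_nonneg (by positivity)]
  exact rpow_le_rpow_of_exponent_le hk0 h

theorem isBigO_natCast_rpow_iff {f : ℕ → ℂ} {r : ℝ} :
    f =O[atTop] (fun k : ℕ => (k : ℝ) ^ r) ↔ ∃ C : ℝ, ∀ k, ‖f k‖ ≤ C * ((k : ℝ) + 1) ^ r := by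
  have key : (fun k : ℕ => (k : ℝ) ^ r) =Θ[atTop] (fun k : ℕ => ((k : ℝ) + 1) ^ r) := by
    have h : (fun k : ℕ => ((k : ℝ) + 1)) ~[atTop] (fun k : ℕ => (k : ℝ)) := by
      apply IsEquivalent.add_isLittleO IsEquivalent.refl
      exact isLittleO_const_left.2
        (Or.inr (tendsto_norm_atTop_atTop.comp tendsto_natCast_atTop_atTop))
    exact h.isTheta.symm.rpow (.of_forall fun k => by positivity)
      (.of_forall fun k => by simpa using! (by positivity : (0 : ℝ) ≤ (k : ℝ) + 1))
  rw [key.isBigO_congr_right, isBigO_nat_atTop_iff]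
  · refine exists_congr fun C => forall_congr' fun k => ?_
    rw [Real.norm_of_nonneg (by positivity)]
  · intro k hk
    have : (0 : ℝ) < ((k : ℝ) + 1) ^ r := by positivity
    exact absurd hk this.ne'

/-- Wendel's inequalities for the ratio of two values of `Γ`. -/
theorem Gamma_natCast_add_bounds {a : ℝ} (h0 : 0 < a) (h1 : a ≤ 1) {k : ℕ} (hk : 1 ≤ k) :
    (k : ℝ) ^ (a - 1) * (1 - a / k) ≤ Gamma (k + a) / Gamma (k + 1) ∧
      Gamma (k + a) / Gamma (k + 1) ≤ (k : ℝ) ^ (a - 1) := by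
  have hk0 : (0 : ℝ) < k := by exact_mod_cast hk
  rcases h1.eq_or_lt with rfl | h1
  · have : Gamma ((k : ℝ) + 1) ≠ 0 := (Gamma_pos_of_pos (by positivity)).ne'
    simp [this]
  have hΓ := Gamma_pos_of_pos hk0
  have hΓa := Gamma_pos_of_pos (show 0 < (k : ℝ) + a by positivity)
  have hΓ1 := Gamma_pos_of_pos (show 0 < (k : ℝ) + 1 by positivity)
  constructor
  · have h := Gamma_mul_add_mul_le_rpow_Gamma_mul_rpow_Gamma
      (show 0 < (k : ℝ) + a by positivity) (show 0 < (k : ℝ) + a + 1 by positivity)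
      h0 (sub_pos.2 h1) (by ring)
    rw [show a * ((k : ℝ) + a) + (1 - a) * (k + a + 1) = k + 1 by ring,
      Gamma_add_one (show (k : ℝ) + a ≠ 0 by positivity), mul_rpow (by positivity) hΓa.le,
      mul_left_comm, ← rpow_add hΓa, add_sub_cancel, rpow_one] at h
    have hb : (1 + a / k) ^ (1 - a) ≤ 1 + (1 - a) * (a / k) :=
      rpow_one_add_le_one_add_mul_self (by have : 0 ≤ a / k := by positivity
                                           linarith) (by linarith) (by linarith)
    have hsplit : ((k : ℝ) + a) ^ (1 - a) = (k : ℝ) ^ (1 - a) * (1 + a / k) ^ (1 - a) := by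
      rw [← mul_rpow hk0.le (by positivity)]; congr 1; field_simp
    have hinv : (k : ℝ) ^ (a - 1) * (k : ℝ) ^ (1 - a) = 1 := by
      rw [← rpow_add hk0]; simp
    rw [le_div_iff₀ hΓ1]
    set y := a / k with hy
    have hy0 : 0 < y := by positivity
    rcases le_or_gt 1 y with hy1 | hy1
    · refine le_trans ?_ hΓa.le
      have : 0 ≤ (k : ℝ) ^ (a - 1) * Gamma (k + 1) := by positivity
      nlinarith
    calc (k : ℝ) ^ (a - 1) * (1 - y) * Gamma (k + 1)
        ≤ (k : ℝ) ^ (a - 1) * (1 - y) *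
          ((k : ℝ) ^ (1 - a) * (1 + (1 - a) * y) * Gamma (k + a)) := by
          refine mul_le_mul_of_nonneg_left (h.trans ?_)
            (mul_nonneg (by positivity) (by linarith))
          rw [hsplit]
          gcongr
      _ = ((k : ℝ) ^ (a - 1) * (k : ℝ) ^ (1 - a)) * ((1 - y) * (1 + (1 - a) * y)) *
          Gamma (k + a) := by ring
      _ ≤ Gamma (k + a) := by
          rw [hinv, one_mul]
          apply mul_le_of_le_one_left hΓa.le
          nlinarith [mul_pos h0 hy0, mul_pos hy0 hy0]
  · have h := Gamma_mul_add_mul_le_rpow_Gamma_mul_rpow_Gamma hk0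
      (show 0 < (k : ℝ) + 1 by positivity) (sub_pos.2 h1) h0 (by ring)
    rw [show (1 - a) * (k : ℝ) + a * (k + 1) = k + a by ring, Gamma_add_one hk0.ne',
      mul_rpow hk0.le hΓ.le, mul_left_comm, ← rpow_add hΓ, sub_add_cancel, rpow_one] at h
    rw [Gamma_add_one hk0.ne', div_le_iff₀ (by positivity), ← mul_assoc,
      ← rpow_add_one hk0.ne', sub_add_cancel]
    exact h

theorem multichoose_sub_isBigO {β : ℝ} (hβ : 0 < β) :
    (fun k : ℕ => Ring.multichoose β k - (k : ℝ) ^ (β - 1) / Gamma β)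
      =O[atTop] (fun k : ℕ => (k : ℝ) ^ (β - 2)) := by
  obtain ⟨N, hN⟩ := exists_nat_ge β
  induction N generalizing β with
  | zero => simp at hN; linarith
  | succ N ih =>
    rcases le_or_gt β 1 with h1 | h1
    · apply IsBigO.of_bound (β / Gamma β)
      filter_upwards [eventually_ge_atTop 1] with k hk
      obtain ⟨hl, hu⟩ := Gamma_natCast_add_bounds hβ h1 hk
      have hk0 : (0 : ℝ) < k := by exact_mod_cast hk
      have hΓ := Gamma_pos_of_pos hβ
      rw [multichoose_eq_Gamma_div hβ, ← div_div, ← sub_div, norm_div, Real.norm_of_nonneg hΓ.le,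
        div_mul_eq_mul_div, Real.norm_of_nonneg (by positivity : 0 ≤ (k : ℝ) ^ (β - 2))]
      gcongr
      rw [Real.norm_of_nonpos (by linarith)]
      have : (k : ℝ) ^ (β - 1) * (1 - β / k) = (k : ℝ) ^ (β - 1) - β * (k : ℝ) ^ (β - 2) := by
        rw [show β - 2 = β - 1 - 1 by ring, rpow_sub_one hk0.ne' (β - 1)]
        ring
      linarith
    · have hβ' : 0 < β - 1 := by linarith
      have := ih hβ' (by push_cast at hN; linarith)
      have hmain : ∀ᶠ k : ℕ in atTop,
          (Ring.multichoose (β - 1) k - (k : ℝ) ^ (β - 1 - 1) / Gamma (β - 1)) *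
            ((k + (β - 1)) / (β - 1)) + (k : ℝ) ^ (β - 2) / Gamma (β - 1)
          = Ring.multichoose β k - (k : ℝ) ^ (β - 1) / Gamma β := by
        filter_upwards [eventually_ge_atTop 1] with k hk
        have hk0 : (0 : ℝ) < k := by exact_mod_cast hk
        have h := mul_multichoose_add_one (β - 1) k
        rw [sub_add_cancel] at h
        have hG : Gamma β = (β - 1) * Gamma (β - 1) := by
          rw [← Gamma_add_one hβ'.ne', sub_add_cancel]
        have hp : (k : ℝ) ^ (β - 1) = (k : ℝ) ^ (β - 2) * k := by
          rw [← rpow_add_one hk0.ne']; ring_nf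
        have hΓ := (Gamma_pos_of_pos hβ').ne'
        rw [hG, hp, show β - 1 - 1 = β - 2 by ring]
        have : Ring.multichoose β k = (β - 1 + k) * Ring.multichoose (β - 1) k / (β - 1) := by
          rw [← h]; field_simp
        rw [this]
        field_simp
        ring
      refine IsBigO.congr' ?_ hmain EventuallyEq.rfl
      refine IsBigO.add ?_ ?_
      · have hlin : (fun k : ℕ => ((k : ℝ) + (β - 1)) / (β - 1)) =O[atTop]
            (fun k : ℕ => (k : ℝ)) := by
          apply IsBigO.of_bound ((1 + (β - 1)) / (β - 1))
          filter_upwards [eventually_ge_atTop 1] with k hk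
          have hk0 : (1 : ℝ) ≤ k := by exact_mod_cast hk
          rw [Real.norm_of_nonneg (by positivity), Real.norm_of_nonneg (by positivity),
            div_mul_eq_mul_div]
          gcongr
          nlinarith
        refine (this.mul hlin).congr' EventuallyEq.rfl ?_
        filter_upwards [eventually_ge_atTop 1] with k hk
        have hk0 : (0 : ℝ) < k := by exact_mod_cast hk
        rw [← rpow_add_one hk0.ne']; ring_nf
      · simp_rw [div_eq_inv_mul]
        exact (isBigO_refl _ _).const_mul_left _

theorem multichoose_isBigO (β : ℝ) :
    (fun k : ℕ => Ring.multichoose β k) =O[atTop] (fun k : ℕ => (k : ℝ) ^ (β - 1)) := by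
  obtain ⟨N, hN⟩ := exists_nat_gt (-β)
  induction N generalizing β with
  | zero =>
    have hβ : 0 < β := by simpa using hN
    have h1 := (multichoose_sub_isBigO hβ).trans
      (isBigO_natCast_rpow_of_le (show β - 2 ≤ β - 1 by linarith))
    have h2 : (fun k : ℕ => (k : ℝ) ^ (β - 1) / Gamma β) =O[atTop]
        (fun k : ℕ => (k : ℝ) ^ (β - 1)) := by
      simp_rw [div_eq_inv_mul]
      exact (isBigO_refl _ _).const_mul_left _
    simpa using h1.add h2
  | succ N ih =>
    have h := ih (β + 1) (by push_cast at hN; linarith)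
    have hlin : (fun k : ℕ => β / (β + k)) =O[atTop] (fun k : ℕ => (k : ℝ)⁻¹) := by
      apply IsBigO.of_bound (2 * |β|)
      filter_upwards [eventually_ge_atTop (⌈2 * |β|⌉₊ + 1)] with k hk
      have h2 : 2 * |β| + 1 ≤ k := (add_le_add_left (Nat.le_ceil _) 1).trans (by exact_mod_cast hk)
      have hb := neg_abs_le β
      have hb' := abs_nonneg β
      have hpos : 0 < β + k := by linarith
      rw [norm_div, norm_inv, Real.norm_of_nonneg hpos.le, Real.norm_eq_abs,
        Real.norm_of_nonneg (by positivity), ← div_eq_mul_inv, div_le_div_iff₀ hpos (by linarith)]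
      nlinarith
    refine (h.mul hlin).congr' ?_ ?_
    · filter_upwards [eventually_ge_atTop (⌈2 * |β|⌉₊ + 1)] with k hk
      have h2 : 2 * |β| + 1 ≤ k := (add_le_add_left (Nat.le_ceil _) 1).trans (by exact_mod_cast hk)
      have hb := neg_abs_le β
      have hb' := abs_nonneg β
      have hpos : 0 < β + k := by linarith
      have := mul_multichoose_add_one β k
      field_simp
      linarith
    · filter_upwards [eventually_ge_atTop 1] with k hk
      have hk0 : (0 : ℝ) < k := by exact_mod_cast hk
      rw [← div_eq_mul_inv, ← rpow_sub_one hk0.ne']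
      ring_nf

theorem summable_natCast_add_one_rpow_neg_two :
    Summable fun j : ℕ => ((j : ℝ) + 1) ^ (-2 : ℝ) := by
  have := (summable_nat_add_iff 1).2 (Real.summable_nat_rpow.2 (show (-2 : ℝ) < -1 by norm_num))
  simpa using this

/-- The coefficients of the power series `f` are `O(k ^ r)`. -/
def CoeffGrowth (f : PowerSeries ℂ) (r : ℝ) : Prop :=
  (fun k : ℕ => PowerSeries.coeff k f) =O[atTop] (fun k : ℕ => (k : ℝ) ^ r)

namespace CoeffGrowth

variable {f g : PowerSeries ℂ} {r r' : ℝ}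

theorem mono (hf : CoeffGrowth f r) (h : r ≤ r') : CoeffGrowth f r' :=
  hf.trans (isBigO_natCast_rpow_of_le h)

theorem add (hf : CoeffGrowth f r) (hg : CoeffGrowth g r) : CoeffGrowth (f + g) r := by
  simpa [CoeffGrowth] using IsBigO.add hf hg

theorem C_mul (c : ℂ) (hf : CoeffGrowth f r) : CoeffGrowth (PowerSeries.C c * f) r := by
  simpa [CoeffGrowth] using IsBigO.const_mul_left hf c

theorem mul (hf : CoeffGrowth f r) (hg : CoeffGrowth g r') (h : r' ≤ -|r| - 2) :
    CoeffGrowth (f * g) r := by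
  have hg := hg.mono h
  obtain ⟨A, hA⟩ := isBigO_natCast_rpow_iff.1 hf
  obtain ⟨B, hB⟩ := isBigO_natCast_rpow_iff.1 hg
  have hA0 : 0 ≤ A := by simpa using (norm_nonneg _).trans (hA 0)
  have hB0 : 0 ≤ B := by simpa using (norm_nonneg _).trans (hB 0)
  refine isBigO_natCast_rpow_iff.2 ⟨A * B * ∑' j : ℕ, ((j : ℝ) + 1) ^ (-2 : ℝ), fun m => ?_⟩
  have peetre : ∀ i j : ℕ, i + j = m → ((i : ℝ) + 1) ^ r ≤ ((m : ℝ) + 1) ^ r * ((j : ℝ) + 1) ^ |r| := by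
    intro i j hij
    have hm : (m : ℝ) = i + j := by exact_mod_cast hij.symm
    have hi0 : (0 : ℝ) ≤ i := by positivity
    have hj0 : (0 : ℝ) ≤ j := by positivity
    rcases le_or_gt 0 r with hr | hr
    · have h1 : ((i : ℝ) + 1) ^ r ≤ ((m : ℝ) + 1) ^ r :=
        rpow_le_rpow (by positivity) (by linarith) hr
      have h2 : 1 ≤ ((j : ℝ) + 1) ^ |r| := one_le_rpow (by linarith) (abs_nonneg r)
      exact h1.trans (le_mul_of_one_le_right (by positivity) h2)
    · have h1 : (((i : ℝ) + 1) * (j + 1)) ^ r ≤ ((m : ℝ) + 1) ^ r :=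
        rpow_le_rpow_of_nonpos (by positivity) (by nlinarith) hr.le
      rw [mul_rpow (by positivity) (by positivity)] at h1
      rw [abs_of_neg hr, rpow_neg (by positivity), ← div_eq_mul_inv, le_div_iff₀ (by positivity)]
      exact h1
  rw [mul_comm f g, PowerSeries.coeff_mul]
  calc ‖∑ p ∈ Finset.HasAntidiagonal.antidiagonal m, PowerSeries.coeff p.1 g * PowerSeries.coeff p.2 f‖
      ≤ ∑ p ∈ Finset.HasAntidiagonal.antidiagonal m,
          A * B * ((m : ℝ) + 1) ^ r * ((p.1 : ℝ) + 1) ^ (-2 : ℝ) := by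
        refine norm_sum_le_of_le _ fun p hp => ?_
        have hp' : p.2 + p.1 = m := by rw [add_comm]; simpa using hp
        rw [norm_mul]
        calc _ ≤ (B * ((p.1 : ℝ) + 1) ^ (-|r| - 2)) * (A * ((p.2 : ℝ) + 1) ^ r) :=
              mul_le_mul (hB _) (hA _) (norm_nonneg _) (by positivity)
          _ ≤ (B * ((p.1 : ℝ) + 1) ^ (-|r| - 2)) *
              (A * (((m : ℝ) + 1) ^ r * ((p.1 : ℝ) + 1) ^ |r|)) := by
              gcongr
              exact peetre _ _ hp'
          _ = A * B * ((m : ℝ) + 1) ^ r *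
              (((p.1 : ℝ) + 1) ^ (-|r| - 2) * ((p.1 : ℝ) + 1) ^ |r|) := by ring
          _ = _ := by
              rw [← rpow_add (by positivity)]
              ring_nf
    _ = A * B * ((m : ℝ) + 1) ^ r * ∑ j ∈ Finset.range m.succ, ((j : ℝ) + 1) ^ (-2 : ℝ) := by
        rw [← Finset.mul_sum,
          Finset.Nat.sum_antidiagonal_eq_sum_range_succ (fun i _ => ((i : ℝ) + 1) ^ (-2 : ℝ))]
    _ ≤ A * B * ((m : ℝ) + 1) ^ r * ∑' j : ℕ, ((j : ℝ) + 1) ^ (-2 : ℝ) := by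
        gcongr
        exact summable_natCast_add_one_rpow_neg_two.sum_le_tsum _ fun j _ => by positivity
    _ = _ := by ring

theorem one_add_X (r : ℝ) : CoeffGrowth (1 + PowerSeries.X) r := by
  apply IsBigO.of_bound 0
  filter_upwards [eventually_ge_atTop 2] with k hk
  have h0 : k ≠ 0 := by omega
  have h1 : k ≠ 1 := by omega
  simp [PowerSeries.coeff_one, PowerSeries.coeff_X, h0, h1]

theorem one_add_X_mul (hf : CoeffGrowth f r) : CoeffGrowth ((1 + PowerSeries.X) * f) r := by
  rw [mul_comm]
  exact hf.mul (one_add_X _) le_rfl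

theorem summable_norm (hf : CoeffGrowth f r) (hr : r < -1) :
    Summable fun k => ‖PowerSeries.coeff k f‖ :=
  summable_of_isBigO_nat (Real.summable_nat_rpow.2 hr) hf.norm_left

/-- Division of a power series with rapidly decaying coefficients by `1 - e X`, with remainder
its value at `e⁻¹`. -/
theorem exists_eq_add_mul {e : ℂ} (he : ‖e‖ = 1) (hf : CoeffGrowth f r) (hr : r ≤ -2) :
    ∃ h : PowerSeries ℂ, CoeffGrowth h (r + 2) ∧
      f = PowerSeries.C (∑' k, PowerSeries.coeff k f * e⁻¹ ^ k) +
        (1 - PowerSeries.C e * PowerSeries.X) * h := by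
  have he0 : e ≠ 0 := by rintro rfl; simp at he
  have hs := hf.summable_norm (by linarith)
  have hsj : ∀ j l : ℕ, Summable fun i => PowerSeries.coeff (i + j) f * e⁻¹ ^ (i + l) := fun j l => by
    apply Summable.of_norm
    simpa [he] using (summable_nat_add_iff j).2 hs
  refine ⟨PowerSeries.mk fun j => -∑' i, PowerSeries.coeff (i + (j + 1)) f * e⁻¹ ^ (i + 1), ?_, ?_⟩
  · obtain ⟨A, hA⟩ := isBigO_natCast_rpow_iff.1 hf
    have hA0 : 0 ≤ A := by simpa using (norm_nonneg _).trans (hA 0)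
    refine isBigO_natCast_rpow_iff.2 ⟨A * ∑' j : ℕ, ((j : ℝ) + 1) ^ (-2 : ℝ), fun j => ?_⟩
    rw [PowerSeries.coeff_mk, norm_neg]
    have hb : ∀ i : ℕ, ‖PowerSeries.coeff (i + (j + 1)) f * e⁻¹ ^ (i + 1)‖ ≤
        A * ((j : ℝ) + 1) ^ (r + 2) * ((i : ℝ) + 1) ^ (-2 : ℝ) := fun i => by
      have hi0 : (0 : ℝ) ≤ i := by positivity
      have hj0 : (0 : ℝ) ≤ j := by positivity
      rw [norm_mul, norm_pow, norm_inv, he, inv_one, one_pow, mul_one]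
      refine (hA _).trans ?_
      push_cast
      rw [mul_assoc]
      refine mul_le_mul_of_nonneg_left ?_ hA0
      rw [show r = (r + 2) + -2 by ring, rpow_add (by positivity)]
      refine mul_le_mul ?_ ?_ (by positivity) (by positivity)
      · rw [show r + 2 + -2 + 2 = r + 2 by ring]
        exact rpow_le_rpow_of_nonpos (by positivity) (by linarith) (by linarith)
      · exact rpow_le_rpow_of_nonpos (by positivity) (by linarith) (by linarith)
    calc _ ≤ ∑' i : ℕ, A * ((j : ℝ) + 1) ^ (r + 2) * ((i : ℝ) + 1) ^ (-2 : ℝ) :=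
          tsum_of_norm_bounded
            (summable_natCast_add_one_rpow_neg_two.mul_left _).hasSum hb
      _ = _ := by rw [tsum_mul_left]; ring
  · ext j
    rw [sub_mul, one_mul, mul_assoc, map_add, map_sub, PowerSeries.coeff_C_mul]
    cases j with
    | zero =>
      have := (hsj 0 0).tsum_eq_zero_add
      simp only [add_zero, inv_pow] at this
      simp [this]
    | succ j =>
      have h1 := (hsj (j + 1) 1).tsum_eq_zero_add
      have h2 : e * ∑' i, PowerSeries.coeff (i + 1 + (j + 1)) f * e⁻¹ ^ (i + 1 + 1) =
          ∑' i, PowerSeries.coeff (i + (j + 1 + 1)) f * e⁻¹ ^ (i + 1) := by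
        rw [← tsum_mul_left]
        congr 1; ext i
        rw [pow_succ e⁻¹ (i + 1), show i + 1 + (j + 1) = i + (j + 1 + 1) by ring]
        field_simp
      rw [PowerSeries.coeff_succ_X_mul, PowerSeries.coeff_mk, PowerSeries.coeff_mk, h1, ← h2]
      simp
      field_simp
      ring

end CoeffGrowth

/-- The binomial expansion of `(1 - e X) ^ (-β)`. -/
noncomputable def negBinomialSeries (e : ℂ) (β : ℝ) : PowerSeries ℂ :=
  PowerSeries.mk fun k => (Ring.multichoose β k : ℝ) * e ^ k

theorem one_sub_mul_negBinomialSeries (e : ℂ) (β : ℝ) :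
    (1 - PowerSeries.C e * PowerSeries.X) * negBinomialSeries e β =
      negBinomialSeries e (β - 1) := by
  ext k
  rw [sub_mul, one_mul, mul_assoc, map_sub, PowerSeries.coeff_C_mul]
  cases k with
  | zero => simp [negBinomialSeries]
  | succ k =>
    have h := Ring.multichoose_succ_succ (β - 1) k
    rw [sub_add_cancel] at h
    rw [PowerSeries.coeff_succ_X_mul]
    simp only [negBinomialSeries, PowerSeries.coeff_mk, h]
    push_cast
    ring

theorem coeffGrowth_negBinomialSeries {e : ℂ} (he : ‖e‖ = 1) (β : ℝ) :
    CoeffGrowth (negBinomialSeries e β) (β - 1) := by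
  refine IsBigO.trans (IsBigO.of_bound 1 (.of_forall fun k => ?_)) (multichoose_isBigO β)
  simp [negBinomialSeries, he]

theorem negBinomialSeries_mul_eq {e₁ e₂ : ℂ} (hne : e₁ ≠ e₂) (β γ : ℝ) :
    negBinomialSeries e₁ β * negBinomialSeries e₂ γ =
      PowerSeries.C (e₂ / (e₂ - e₁)) *
          (negBinomialSeries e₁ (β - 1) * negBinomialSeries e₂ γ) +
        PowerSeries.C (e₁ / (e₁ - e₂)) *
          (negBinomialSeries e₁ β * negBinomialSeries e₂ (γ - 1)) := by
  rw [← one_sub_mul_negBinomialSeries e₁ β, ← one_sub_mul_negBinomialSeries e₂ γ]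
  have h1 : e₁ - e₂ ≠ 0 := sub_ne_zero.2 hne
  have h2 : e₂ - e₁ ≠ 0 := sub_ne_zero.2 hne.symm
  have a1 : PowerSeries.C (e₂ / (e₂ - e₁)) + PowerSeries.C (e₁ / (e₁ - e₂)) = 1 := by
    rw [← map_add, ← map_one PowerSeries.C, ← neg_sub e₂ e₁]
    congr 1
    field_simp
    ring
  have a2 : PowerSeries.C (e₂ / (e₂ - e₁)) * PowerSeries.C e₁ +
      PowerSeries.C (e₁ / (e₁ - e₂)) * PowerSeries.C e₂ = 0 := by
    rw [← map_mul, ← map_mul, ← map_add, ← map_zero PowerSeries.C, ← neg_sub e₂ e₁]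
    congr 1
    field_simp
    ring
  linear_combination (negBinomialSeries e₁ β * negBinomialSeries e₂ γ) * (PowerSeries.X * a2 - a1)

theorem coeffGrowth_negBinomialSeries_mul {e₁ e₂ : ℂ} (h₁ : ‖e₁‖ = 1) (h₂ : ‖e₂‖ = 1)
    (hne : e₁ ≠ e₂) {β γ r : ℝ} (hβ : β ≤ r) (hγ : γ ≤ r) :
    CoeffGrowth (negBinomialSeries e₁ β * negBinomialSeries e₂ γ) (r - 1) := by
  set L : ℝ := -|r - 1| - 1 with hL
  obtain ⟨N, hN⟩ := exists_nat_ge (β + γ - 2 * L)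
  induction N generalizing β γ with
  | zero =>
    have : β ≤ L ∨ γ ≤ L := by
      by_contra! h
      simp at hN
      linarith
    rcases this with h | h
    · rw [mul_comm]
      exact ((coeffGrowth_negBinomialSeries h₂ γ).mono (by linarith)).mul
        (coeffGrowth_negBinomialSeries h₁ β) (by linarith)
    · exact ((coeffGrowth_negBinomialSeries h₁ β).mono (by linarith)).mul
        (coeffGrowth_negBinomialSeries h₂ γ) (by linarith)
  | succ N ih =>
    push_cast at hN
    rw [negBinomialSeries_mul_eq hne]
    exact ((ih (by linarith) hγ (by linarith)).C_mul _).add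
      ((ih hβ (by linarith) (by linarith)).C_mul _)

theorem exists_negBinomialSeries_mul_eq_add {e₁ e₂ : ℂ} (h₁ : ‖e₁‖ = 1) (h₂ : ‖e₂‖ = 1)
    (hne : e₁ ≠ e₂) (α : ℝ) (N : ℕ) :
    ∃ R, CoeffGrowth R (α - 2) ∧ negBinomialSeries e₁ α * negBinomialSeries e₂ α =
      PowerSeries.C ((e₂ / (e₂ - e₁)) ^ (N + 1)) *
          (negBinomialSeries e₁ (α - (N + 1 : ℕ)) * negBinomialSeries e₂ α) +
        PowerSeries.C ((e₁ / (e₁ - e₂)) ^ (N + 1)) *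
          (negBinomialSeries e₂ (α - (N + 1 : ℕ)) * negBinomialSeries e₁ α) + R := by
  induction N with
  | zero =>
    refine ⟨0, by simpa [CoeffGrowth] using isBigO_zero _ _, ?_⟩
    simpa [mul_comm] using negBinomialSeries_mul_eq hne α α
  | succ N ih =>
    obtain ⟨R, hR, h⟩ := ih
    have hN : α - (N + 1 : ℕ) ≤ α - 1 := by push_cast; linarith [N.cast_nonneg (α := ℝ)]
    refine ⟨R + PowerSeries.C ((e₂ / (e₂ - e₁)) ^ (N + 1)) * (PowerSeries.C (e₁ / (e₁ - e₂)) *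
        (negBinomialSeries e₁ (α - (N + 1 : ℕ)) * negBinomialSeries e₂ (α - 1))) +
      PowerSeries.C ((e₁ / (e₁ - e₂)) ^ (N + 1)) * (PowerSeries.C (e₂ / (e₂ - e₁)) *
        (negBinomialSeries e₂ (α - (N + 1 : ℕ)) * negBinomialSeries e₁ (α - 1))), ?_, ?_⟩
    · have g1 := coeffGrowth_negBinomialSeries_mul h₁ h₂ hne hN (le_refl (α - 1))
      have g2 := coeffGrowth_negBinomialSeries_mul h₂ h₁ hne.symm hN (le_refl (α - 1))
      rw [show α - 1 - 1 = α - 2 by ring] at g1 g2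
      exact (hR.add ((g1.C_mul _).C_mul _)).add ((g2.C_mul _).C_mul _)
    · rw [h, negBinomialSeries_mul_eq hne (α - (N + 1 : ℕ)) α,
        negBinomialSeries_mul_eq hne.symm (α - (N + 1 : ℕ)) α,
        show α - ((N + 1 + 1 : ℕ) : ℝ) = α - (N + 1 : ℕ) - 1 by push_cast; ring,
        pow_succ _ (N + 1), pow_succ _ (N + 1), map_mul, map_mul]
      ring

/-- The power series `f` converges to the function `F` on the open unit disc. -/
def HasDiscSum (f : PowerSeries ℂ) (F : ℂ → ℂ) : Prop :=
  ∀ z : ℂ, ‖z‖ < 1 → HasSum (fun k => PowerSeries.coeff k f * z ^ k) (F z)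

namespace HasDiscSum

variable {f g : PowerSeries ℂ} {F G : ℂ → ℂ}

theorem mul (hf : HasDiscSum f F) (hg : HasDiscSum g G) :
    HasDiscSum (f * g) (fun z => F z * G z) := by
  intro z hz
  have h1 := (hf z hz).summable.norm
  have h2 := (hg z hz).summable.norm
  have h3 := (summable_norm_sum_mul_antidiagonal_of_summable_norm h1 h2).of_norm.hasSum
  rw [← tsum_mul_tsum_eq_tsum_sum_antidiagonal_of_summable_norm h1 h2, (hf z hz).tsum_eq,
    (hg z hz).tsum_eq] at h3
  have hcauchy : (fun m => PowerSeries.coeff m (f * g) * z ^ m) = fun m =>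
      ∑ p ∈ Finset.HasAntidiagonal.antidiagonal m,
        PowerSeries.coeff p.1 f * z ^ p.1 * (PowerSeries.coeff p.2 g * z ^ p.2) := by
    ext m
    rw [PowerSeries.coeff_mul, Finset.sum_mul]
    refine Finset.sum_congr rfl fun p hp => ?_
    rw [← Finset.HasAntidiagonal.mem_antidiagonal.1 hp, pow_add]
    ring
  rw [hcauchy]
  exact h3

theorem C_mul (c : ℂ) (hf : HasDiscSum f F) :
    HasDiscSum (PowerSeries.C c * f) (fun z => c * F z) := by
  intro z hz
  simpa [mul_assoc] using (hf z hz).mul_left c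

theorem one_add_X : HasDiscSum (1 + PowerSeries.X) (fun z => 1 + z) := by
  intro z _
  have h := hasSum_sum_of_ne_finset_zero (L := SummationFilter.unconditional ℕ)
    (f := fun k => PowerSeries.coeff k (1 + PowerSeries.X : PowerSeries ℂ) * z ^ k)
    (s := Finset.range 2) fun k hk => by
      simp only [Finset.mem_range, not_lt] at hk
      have h0 : k ≠ 0 := by omega
      have h1 : k ≠ 1 := by omega
      simp [PowerSeries.coeff_one, PowerSeries.coeff_X, h0, h1]
  simpa [Finset.sum_range_succ, PowerSeries.coeff_one, PowerSeries.coeff_X] using h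

theorem hasFPowerSeriesAt (hf : HasDiscSum f F) :
    HasFPowerSeriesAt F (.ofScalars ℂ fun k => PowerSeries.coeff k f) 0 := by
  refine ⟨(2⁻¹ : NNReal), ?_, by simp, fun {y} hy => ?_⟩
  · apply FormalMultilinearSeries.le_radius_of_summable_norm
    have := (hf 2⁻¹ (by norm_num)).summable.norm
    simpa [FormalMultilinearSeries.ofScalars_norm] using this
  · have hy' : ‖y‖ < 1 := by
      have : ‖y‖ < 2⁻¹ := by
        rw [Metric.eball_coe] at hy
        simpa using hy
      linarith
    simpa [FormalMultilinearSeries.ofScalars_apply_eq, mul_comm] using hf y hy'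

theorem unique (hf : HasDiscSum f F) (hg : HasDiscSum g F) : f = g := by
  have h := hf.hasFPowerSeriesAt.eq_formalMultilinearSeries hg.hasFPowerSeriesAt
  ext k
  exact congr_fun (FormalMultilinearSeries.ofScalars_series_injective ℂ ℂ h) k

/-- Abel's theorem: an absolutely convergent boundary value is the radial limit. -/
theorem tsum_boundary_eq (hf : HasDiscSum f F) (hs : Summable fun k => ‖PowerSeries.coeff k f‖)
    {w : ℂ} (hw : ‖w‖ = 1) (hF : ContinuousAt F w) :
    ∑' k, PowerSeries.coeff k f * w ^ k = F w := by
  have hsw : Summable fun k => PowerSeries.coeff k f * w ^ k := by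
    apply Summable.of_norm
    simpa [hw] using hs
  have h1 := Complex.tendsto_tsum_powerSeries_nhdsWithin_lt hsw.hasSum.tendsto_sum_nat
  rw [tendsto_map'_iff] at h1
  refine tendsto_nhds_unique h1 ?_
  have h2 : Tendsto (fun x : ℝ => F ((x : ℂ) * w)) (nhdsWithin 1 (Set.Iio 1)) (nhds (F w)) := by
    have hc : Tendsto (fun x : ℝ => (x : ℂ) * w) (nhds 1) (nhds w) := by
      have : Continuous fun x : ℝ => (x : ℂ) * w := by fun_prop
      simpa using this.tendsto 1
    exact hF.tendsto.comp (hc.mono_left nhdsWithin_le_nhds)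
  refine h2.congr' ?_
  filter_upwards [Ioo_mem_nhdsLT (show (0 : ℝ) < 1 by norm_num)] with x hx
  have hxw : ‖(x : ℂ) * w‖ < 1 := by
    rw [norm_mul, hw, mul_one, Complex.norm_real, Real.norm_of_nonneg hx.1.le]
    exact hx.2
  rw [← (hf _ hxw).tsum_eq]
  exact tsum_congr fun k => by ring

end HasDiscSum

theorem hasDiscSum_negBinomialSeries {e : ℂ} (he : ‖e‖ = 1) (β : ℝ) :
    HasDiscSum (negBinomialSeries e β) (fun z => 1 / (1 - e * z) ^ (β : ℂ)) := by
  intro z hz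
  have h := (Complex.one_div_one_sub_cpow_hasFPowerSeriesOnBall_zero (β : ℂ)).hasSum
    (y := e * z) (by
      rw [← ENNReal.ofReal_one, Metric.eball_ofReal]
      simpa [he] using hz)
  have hc : ∀ k : ℕ, Ring.choose ((β : ℂ) + k - 1) k = ((Ring.multichoose β k : ℝ) : ℂ) := by
    intro k
    rw [← Ring.multichoose_eq]
    exact (Ring.map_multichoose Complex.ofRealHom β k).symm
  simpa [FormalMultilinearSeries.ofScalars_apply_eq, hc, negBinomialSeries, mul_pow, mul_comm,
    mul_left_comm, mul_assoc] using h

theorem one_sub_sq_re_pos {e : ℂ} (he : ‖e‖ = 1) (hne : e ≠ e⁻¹) : 0 < (1 - e * e).re := by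
  have h1 : e.re * e.re + e.im * e.im = 1 := by
    rw [← Complex.normSq_apply, Complex.normSq_eq_norm_sq, he]; norm_num
  have h2 : e.im ≠ 0 := by
    intro h
    apply hne
    rw [Complex.inv_eq_conj he]
    exact (Complex.conj_eq_iff_im.2 h).symm
  have h3 : 0 < e.im * e.im := mul_self_pos.2 h2
  simp
  linarith

/-- The contribution of the singularity at `e`, up to coefficients of lower order. -/
theorem exists_coeffGrowth_one_add_X_mul {e : ℂ} (he : ‖e‖ = 1) (hne : e ≠ e⁻¹) (α : ℝ) :
    ∃ N₀ : ℕ, ∀ N : ℕ, N₀ ≤ N → ∃ R, CoeffGrowth R (α - 2) ∧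
      (1 + PowerSeries.X) * (PowerSeries.C ((e⁻¹ / (e⁻¹ - e)) ^ N) *
        (negBinomialSeries e (α - N) * negBinomialSeries e⁻¹ α)) =
      PowerSeries.C ((1 + e) / (1 - e * e) ^ (α : ℂ)) * negBinomialSeries e⁻¹ α + R := by
  obtain ⟨N₀, hN₀⟩ := exists_nat_ge (|α - 2| + |α| + 3)
  refine ⟨N₀, fun N hN => ?_⟩
  have hN' : |α - 2| + |α| + 3 ≤ N := hN₀.trans (by exact_mod_cast hN)
  have ha := le_abs_self α
  have ha' := abs_nonneg (α - 2)
  have he' : ‖e⁻¹‖ = 1 := by simp [he]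
  have he0 : e ≠ 0 := by rintro rfl; simp at he
  have hpos := one_sub_sq_re_pos he hne
  have hA : 1 - e * e ≠ 0 := fun h => by simp [h] at hpos
  set G := (1 + PowerSeries.X) * negBinomialSeries e (α - N) with hG
  have hGg : CoeffGrowth G (α - N - 1) := (coeffGrowth_negBinomialSeries he _).one_add_X_mul
  obtain ⟨H, hH, hGH⟩ := hGg.exists_eq_add_mul he' (by linarith)
  have hval := (HasDiscSum.one_add_X.mul (hasDiscSum_negBinomialSeries he (α - N))).tsum_boundary_eq
    (hGg.summable_norm (by linarith)) he (by
      have : ContinuousAt (fun z : ℂ => (1 - e * z) ^ ((α - N : ℝ) : ℂ)) e :=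
        ContinuousAt.cpow (by fun_prop) (by fun_prop) (Or.inl hpos)
      have h0 : (1 - e * e) ^ ((α - N : ℝ) : ℂ) ≠ 0 := by simp [Complex.cpow_eq_zero_iff, hA]
      fun_prop (disch := assumption))
  rw [inv_inv, hval] at hGH
  refine ⟨PowerSeries.C ((e⁻¹ / (e⁻¹ - e)) ^ N) * (negBinomialSeries e⁻¹ (α - 1) * H),
    CoeffGrowth.C_mul _ (CoeffGrowth.mul ?_ hH (by linarith)), ?_⟩
  · have := coeffGrowth_negBinomialSeries he' (α - 1)
    rwa [show α - 1 - 1 = α - 2 by ring] at this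
  · have hp : e⁻¹ / (e⁻¹ - e) = (1 - e * e)⁻¹ := by
      have : e⁻¹ - e ≠ 0 := sub_ne_zero.2 hne.symm
      field_simp
    have hK : (1 + e) / (1 - e * e) ^ (α : ℂ) = (e⁻¹ / (e⁻¹ - e)) ^ N *
        ((1 + e) * (1 / (1 - e * e) ^ ((α - N : ℝ) : ℂ))) := by
      push_cast
      rw [hp, Complex.cpow_sub _ _ hA, Complex.cpow_natCast, one_div_div, inv_pow]
      have := pow_ne_zero N hA
      generalize (1 - e * e) ^ N = y at *
      field_simp
    rw [hK, ← one_sub_mul_negBinomialSeries e⁻¹ α, map_mul]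
    linear_combination (PowerSeries.C ((e⁻¹ / (e⁻¹ - e)) ^ N) * negBinomialSeries e⁻¹ α) * hGH

/-- Darboux's principle for `(1 + z) (1 - e z) ^ (-α) (1 - e⁻¹ z) ^ (-α)`. -/
theorem coeffGrowth_one_add_X_mul_sub {e : ℂ} (he : ‖e‖ = 1) (hne : e ≠ e⁻¹) (α : ℝ) :
    ∃ R, CoeffGrowth R (α - 2) ∧
      (1 + PowerSeries.X) * (negBinomialSeries e α * negBinomialSeries e⁻¹ α) =
      PowerSeries.C ((1 + e) / (1 - e * e) ^ (α : ℂ)) * negBinomialSeries e⁻¹ α +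
      PowerSeries.C ((1 + e⁻¹) / (1 - e⁻¹ * e⁻¹) ^ (α : ℂ)) * negBinomialSeries e α + R := by
  have he' : ‖e⁻¹‖ = 1 := by simp [he]
  obtain ⟨N₁, h₁⟩ := exists_coeffGrowth_one_add_X_mul he hne α
  obtain ⟨N₂, h₂⟩ := exists_coeffGrowth_one_add_X_mul he' (by simpa using hne.symm) α
  obtain ⟨R, hR, h⟩ := exists_negBinomialSeries_mul_eq_add he he' hne α (N₁ + N₂)
  obtain ⟨R₁, hR₁, h₁⟩ := h₁ (N₁ + N₂ + 1) (by omega)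
  obtain ⟨R₂, hR₂, h₂⟩ := h₂ (N₁ + N₂ + 1) (by omega)
  rw [inv_inv] at h₂
  refine ⟨R₁ + R₂ + (1 + PowerSeries.X) * R, (hR₁.add hR₂).add hR.one_add_X_mul, ?_⟩
  rw [h]
  linear_combination h₁ + h₂

theorem one_add_sq_sub_cpow {e z : ℂ} (he : ‖e‖ = 1) (hz : ‖z‖ < 1) {t : ℝ}
    (ht : e + e⁻¹ = 2 * t) (a : ℂ) :
    (1 + z ^ 2 - 2 * z * t) ^ a = (1 - e * z) ^ a * (1 - e⁻¹ * z) ^ a := by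
  have he0 : e ≠ 0 := by rintro rfl; simp at he
  have hfac : 1 + z ^ 2 - 2 * z * t = (1 - e * z) * (1 - e⁻¹ * z) := by
    linear_combination z * ht - z ^ 2 * mul_inv_cancel₀ he0
  have hre : ∀ u : ℂ, ‖u‖ = 1 → 0 < (1 - u * z).re := by
    intro u hu
    have : (u * z).re ≤ ‖u * z‖ := Complex.re_le_norm _
    rw [norm_mul, hu, one_mul] at this
    simp only [Complex.sub_re, Complex.one_re]
    linarith
  have h1 := hre e he
  have h2 := hre e⁻¹ (by simp [he])
  have n1 : 1 - e * z ≠ 0 := fun h => by simp [h] at h1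
  have n2 : 1 - e⁻¹ * z ≠ 0 := fun h => by simp [h] at h2
  have a1 := abs_lt.1 (Complex.abs_arg_lt_pi_div_two_iff.2 (Or.inl h1))
  have a2 := abs_lt.1 (Complex.abs_arg_lt_pi_div_two_iff.2 (Or.inl h2))
  rw [hfac, Complex.cpow_def_of_ne_zero (mul_ne_zero n1 n2), Complex.cpow_def_of_ne_zero n1,
    Complex.cpow_def_of_ne_zero n2, Complex.log_mul n1 n2 ⟨by linarith, by linarith⟩, add_mul,
    Complex.exp_add]

theorem ofReal_mul_exp_cpow {ρ θ : ℝ} (hρ : 0 < ρ) (hθ : |θ| < Real.pi) (α : ℝ) :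
    ((ρ : ℂ) * Complex.exp (θ * Complex.I)) ^ (α : ℂ) =
      (ρ ^ α : ℝ) * Complex.exp ((α * θ : ℝ) * Complex.I) := by
  have h := abs_lt.1 hθ
  have hρ0 : (ρ : ℂ) ≠ 0 := by exact_mod_cast hρ.ne'
  rw [Complex.cpow_def_of_ne_zero (mul_ne_zero hρ0 (Complex.exp_ne_zero _)),
    Complex.log_ofReal_mul hρ (Complex.exp_ne_zero _),
    Complex.log_exp (by simpa using h.1) (by simpa using h.2.le), Complex.ofReal_cpow hρ.le,
    Complex.cpow_def_of_ne_zero hρ0, Complex.ofReal_log hρ.le, add_mul, Complex.exp_add]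
  push_cast
  ring_nf

/-- The residual constant at the singularity `exp (i σ)`, in polar form. -/
theorem one_add_div_one_sub_sq_cpow {ρ σ θ : ℝ} (hρ : 0 < ρ) (hθ : |θ| < Real.pi)
    (h : 1 - Complex.exp (σ * Complex.I) * Complex.exp (σ * Complex.I) =
      ρ * Complex.exp (θ * Complex.I)) (α : ℝ) :
    (1 + Complex.exp (σ * Complex.I)) /
      (1 - Complex.exp (σ * Complex.I) * Complex.exp (σ * Complex.I)) ^ (α : ℂ) =
      ((2 * Real.cos (σ / 2) / ρ ^ α : ℝ) : ℂ) *
        Complex.exp ((σ / 2 - α * θ : ℝ) * Complex.I) := by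
  rw [h, ofReal_mul_exp_cpow hρ hθ]
  have h1 : 1 + Complex.exp (σ * Complex.I) =
      2 * (Real.cos (σ / 2) : ℂ) * Complex.exp ((σ / 2 : ℝ) * Complex.I) := by
    rw [Complex.ofReal_cos, Complex.two_cos, add_mul, ← Complex.exp_add, ← Complex.exp_add, add_comm]
    congr 1
    · push_cast; ring_nf
    · push_cast; ring_nf; simp
  have hρα : ((ρ ^ α : ℝ) : ℂ) ≠ 0 := by exact_mod_cast (rpow_pos_of_pos hρ α).ne'
  rw [h1, Complex.ofReal_sub, sub_mul, Complex.exp_sub]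
  push_cast
  have := Complex.exp_ne_zero ((α * θ : ℂ) * Complex.I)
  field_simp

theorem exp_ofReal_mul_I_ne_inv {s : ℝ} (hs : s ∈ Set.Ioo 0 Real.pi) :
    Complex.exp (s * Complex.I) ≠ (Complex.exp (s * Complex.I))⁻¹ := by
  intro h
  rw [Complex.inv_eq_conj (Complex.norm_exp_ofReal_mul_I s)] at h
  have h1 := Complex.conj_eq_iff_im.1 h.symm
  rw [Complex.exp_ofReal_mul_I_im] at h1
  exact (Real.sin_pos_of_mem_Ioo hs).ne' h1

theorem one_sub_exp_mul_exp (s : ℝ) :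
    1 - Complex.exp (s * Complex.I) * Complex.exp (s * Complex.I) =
      ((2 * Real.sin s : ℝ) : ℂ) * Complex.exp ((s - Real.pi / 2 : ℝ) * Complex.I) := by
  have h := Complex.exp_pi_div_two_mul_I
  have e1 : Complex.exp ((s - Real.pi / 2 : ℝ) * Complex.I) =
      Complex.exp (s * Complex.I) * -Complex.I := by
    push_cast
    rw [sub_mul, Complex.exp_sub, h, div_eq_mul_inv, Complex.inv_I]
  rw [e1]
  push_cast
  rw [Complex.two_sin, neg_mul, Complex.exp_neg]
  have := Complex.exp_ne_zero (s * Complex.I)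
  field_simp
  linear_combination (1 - Complex.exp (s * Complex.I) ^ 2) * Complex.I_sq

/-- The two singular contributions add up to a real oscillating term. -/
theorem singular_contributions_add {s : ℝ} (hs : s ∈ Set.Ioo 0 Real.pi) (α : ℝ) (m : ℕ) :
    (1 + Complex.exp (s * Complex.I)) /
        (1 - Complex.exp (s * Complex.I) * Complex.exp (s * Complex.I)) ^ (α : ℂ) *
          (Complex.exp (s * Complex.I))⁻¹ ^ m +
      (1 + (Complex.exp (s * Complex.I))⁻¹) /
        (1 - (Complex.exp (s * Complex.I))⁻¹ * (Complex.exp (s * Complex.I))⁻¹) ^ (α : ℂ) *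
          Complex.exp (s * Complex.I) ^ m =
      ((4 * Real.cos (s / 2) / (2 * Real.sin s) ^ α *
        Real.cos ((α - 1 / 2 + m) * s - α * Real.pi / 2) : ℝ) : ℂ) := by
  have hsin := Real.sin_pos_of_mem_Ioo hs
  have hθ : |s - Real.pi / 2| < Real.pi :=
    abs_lt.2 ⟨by linarith [hs.1, Real.pi_pos], by linarith [hs.2, Real.pi_pos]⟩
  have hinv : (Complex.exp (s * Complex.I))⁻¹ = Complex.exp ((-s : ℝ) * Complex.I) := by
    rw [← Complex.exp_neg]; push_cast; ring_nf
  have h2 : 1 - Complex.exp ((-s : ℝ) * Complex.I) * Complex.exp ((-s : ℝ) * Complex.I) =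
      ((2 * Real.sin s : ℝ) : ℂ) * Complex.exp ((-(s - Real.pi / 2) : ℝ) * Complex.I) := by
    have h := congrArg (starRingEnd ℂ) (one_sub_exp_mul_exp s)
    simpa only [map_sub, map_mul, map_one, ← Complex.exp_conj, Complex.conj_ofReal, Complex.conj_I,
      mul_neg, Complex.ofReal_neg, neg_mul] using h
  rw [hinv, one_add_div_one_sub_sq_cpow (by positivity) hθ (one_sub_exp_mul_exp s),
    one_add_div_one_sub_sq_cpow (by positivity) (by rwa [abs_neg]) h2, ← Complex.exp_nat_mul,
    ← Complex.exp_nat_mul, mul_assoc, mul_assoc, ← Complex.exp_add, ← Complex.exp_add, neg_div,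
    Real.cos_neg, ← mul_add]
  set φ := (α - 1 / 2 + m) * s - α * Real.pi / 2 with hφ
  have hcos : Complex.exp (((s / 2 - α * (s - Real.pi / 2) : ℝ) : ℂ) * Complex.I +
        m * (((-s : ℝ) : ℂ) * Complex.I)) +
      Complex.exp (((-(s / 2) - α * -(s - Real.pi / 2) : ℝ) : ℂ) * Complex.I +
        m * ((s : ℂ) * Complex.I)) = 2 * Complex.cos (φ : ℂ) := by
    rw [Complex.two_cos, add_comm, hφ]
    push_cast
    congr 2 <;> ring
  rw [hcos]
  push_cast
  ring

/-- Darboux asymptotics of the Taylor coefficients `a_m` of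
`F(z) = (1+z)/(D_n (1+z²−2z cos s)^{(n+1)/2})` on the unit disc, where
`D_n = 2π^{(n+1)/2}/Γ((n+1)/2)`: for `m ≥ 1`,
`a_m = (2 cos(s/2)/(2π sin s)^{(n+1)/2}) m^{(n−1)/2} cos((n/2+m)s − (n+1)π/4) + O(m^{(n−3)/2})`. -/
theorem sphere_spectral_function_darboux_asymptotics
    (n : ℕ) (hn : 2 ≤ n) (s : ℝ) (hs : s ∈ Set.Ioo 0 Real.pi)
    (a : ℕ → ℂ)
    (ha : ∀ z : ℂ, ‖z‖ < 1 → HasSum (fun m : ℕ => a m * z ^ m)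
      ((1 + z) /
        (((2 * Real.pi ^ (((n : ℝ) + 1) / 2) / Real.Gamma (((n : ℝ) + 1) / 2) : ℝ) : ℂ) *
          (1 + z ^ 2 - 2 * z * ((Real.cos s : ℝ) : ℂ)) ^ (((n : ℂ) + 1) / 2)))) :
    ∃ C : ℝ, ∀ m : ℕ, 1 ≤ m →
      ‖a m - ((2 * Real.cos (s / 2) / (2 * Real.pi * Real.sin s) ^ (((n : ℝ) + 1) / 2) *
          (m : ℝ) ^ (((n : ℝ) - 1) / 2) *
          Real.cos (((n : ℝ) / 2 + m) * s - ((n : ℝ) + 1) * Real.pi / 4) : ℝ) : ℂ)‖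
        ≤ C * (m : ℝ) ^ (((n : ℝ) - 3) / 2) := by
  set α : ℝ := ((n : ℝ) + 1) / 2 with hα
  set D : ℝ := 2 * Real.pi ^ α / Real.Gamma α with hD
  set e : ℂ := Complex.exp (s * Complex.I) with he_def
  have hα0 : 0 < α := by positivity
  have hΓ := Gamma_pos_of_pos hα0
  have hD0 : 0 < D := by positivity
  have hsin := Real.sin_pos_of_mem_Ioo hs
  have he : ‖e‖ = 1 := Complex.norm_exp_ofReal_mul_I s
  have he' : ‖e⁻¹‖ = 1 := by simp [he]
  have hcos : e + e⁻¹ = 2 * (Real.cos s : ℝ) := by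
    rw [he_def, ← Complex.exp_neg, Complex.ofReal_cos, Complex.two_cos, neg_mul]
  obtain ⟨R, hR, hF⟩ := coeffGrowth_one_add_X_mul_sub he (exp_ofReal_mul_I_ne_inv hs) α
  have hmk : PowerSeries.mk a = PowerSeries.C ((D : ℂ)⁻¹) *
      ((1 + PowerSeries.X) * (negBinomialSeries e α * negBinomialSeries e⁻¹ α)) := by
    refine HasDiscSum.unique (F := _) (fun z hz => ?_)
      ((HasDiscSum.one_add_X.mul ((hasDiscSum_negBinomialSeries he α).mul
        (hasDiscSum_negBinomialSeries he' α))).C_mul _)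
    have h := ha z hz
    rw [show ((n : ℂ) + 1) / 2 = (α : ℂ) by rw [hα]; push_cast; ring,
      one_add_sq_sub_cpow he hz hcos] at h
    simp only [PowerSeries.coeff_mk]
    convert h using 1
    simp only [div_eq_mul_inv, mul_inv, one_mul]
    ring
  set K : ℂ := (1 + e) / (1 - e * e) ^ (α : ℂ) with hK
  set K' : ℂ := (1 + e⁻¹) / (1 - e⁻¹ * e⁻¹) ^ (α : ℂ) with hK'
  have hbig : (fun m : ℕ => a m - (D : ℂ)⁻¹ *
      (((m : ℝ) ^ (α - 1) / Gamma α : ℝ) * (K * e⁻¹ ^ m + K' * e ^ m)))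
      =O[atTop] (fun m : ℕ => (m : ℝ) ^ (α - 2)) := by
    have hosc : (fun m : ℕ => K * e⁻¹ ^ m + K' * e ^ m) =O[atTop] (fun _ : ℕ => (1 : ℝ)) := by
      refine IsBigO.of_bound (‖K‖ + ‖K'‖) (.of_forall fun m => ?_)
      refine (norm_add_le _ _).trans ?_
      simp [he]
    have h1 : (fun m : ℕ => ((Ring.multichoose α m - (m : ℝ) ^ (α - 1) / Gamma α : ℝ) : ℂ))
        =O[atTop] (fun m : ℕ => (m : ℝ) ^ (α - 2)) :=
      Complex.isBigO_ofReal_left.2 (multichoose_sub_isBigO hα0)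
    have h2 := h1.mul hosc
    simp only [mul_one] at h2
    refine ((h2.add hR).const_mul_left (D : ℂ)⁻¹).congr_left fun m => ?_
    have hm := congrArg (PowerSeries.coeff m) hmk
    rw [PowerSeries.coeff_mk, PowerSeries.coeff_C_mul, hF] at hm
    simp only [map_add, PowerSeries.coeff_C_mul, negBinomialSeries, PowerSeries.coeff_mk] at hm
    rw [hm]
    push_cast
    ring
  obtain ⟨C, -, hC⟩ := bound_of_isBigO_nat_atTop hbig
  refine ⟨C, fun m hm => ?_⟩
  have hm0 : (0 : ℝ) < m := by exact_mod_cast hm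
  have h := hC (rpow_pos_of_pos hm0 (α - 2)).ne'
  rw [Real.norm_of_nonneg (by positivity), hK, hK', singular_contributions_add hs α m] at h
  rw [show ((n : ℝ) - 3) / 2 = α - 2 by rw [hα]; ring,
    show ((n : ℝ) - 1) / 2 = α - 1 by rw [hα]; ring]
  convert h using 3
  rw [← Complex.ofReal_inv, ← Complex.ofReal_mul, ← Complex.ofReal_mul]
  congr 1
  rw [show ((n : ℝ) / 2 + m) * s - ((n : ℝ) + 1) * Real.pi / 4 =
      (α - 1 / 2 + m) * s - α * Real.pi / 2 by rw [hα]; ring,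
    show 2 * Real.pi * Real.sin s = Real.pi * (2 * Real.sin s) by ring,
    mul_rpow Real.pi_pos.le (by positivity), hD]
  have := rpow_pos_of_pos Real.pi_pos α
  have := rpow_pos_of_pos (show 0 < 2 * Real.sin s by positivity) α
  field_simp
  ring
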